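/- The graph F(8,12,3), defined as the simple graph on vertex set {1,...,8} with edge set {{1,2},{2,4},{3,4},{1,3},{3,5},{5,7},{7,8},{6,8},{4,6},{5,6},{1,8},{2,7}}, is forbidden: there is no injective map φ : {1,...,8} → ℝ² with dist(φ(i), φ(j)) = 1 for every edge {i,j}. -/

import Mathlib

theorem rhomb_alg (e f m n g h : ℝ) (h1 : e * g + f * h = 0) (h2 : e * m + f * n = 0)
    (h3 : g * m + h * n = 0) (he : ¬ (e = 0 ∧ f = 0)) (hg : ¬ (g = 0 ∧ h = 0)) :
    m = 0 ∧ n = 0 := by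
  have hd : g * n - h * m = 0 := by
    by_contra hne
    apply he
    constructor
    · have : e * (g * n - h * m) = 0 := by linear_combination n * h1 - h * h2
      exact (mul_eq_zero.1 this).resolve_right hne
    · have : f * (g * n - h * m) = 0 := by linear_combination g * h2 - m * h1
      exact (mul_eq_zero.1 this).resolve_right hne
  have hp : g * g + h * h ≠ 0 := by
    intro h0
    apply hg
    constructor <;> nlinarith [mul_self_nonneg g, mul_self_nonneg h]
  constructor
  · have : (g * g + h * h) * m = 0 := by linear_combination g * h3 - h * hd
    exact (mul_eq_zero.1 this).resolve_left hp
  · have : (g * g + h * h) * n = 0 := by linear_combination h * h3 + g * hd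
    exact (mul_eq_zero.1 this).resolve_left hp

theorem dist_one_coord (a b : EuclideanSpace ℝ (Fin 2)) (h : dist a b = 1) :
    (a 0 - b 0) ^ 2 + (a 1 - b 1) ^ 2 = 1 := by
  rw [EuclideanSpace.dist_eq, Real.sqrt_eq_one] at h
  simpa [Fin.sum_univ_two, Real.dist_eq, sq_abs] using h

theorem rhomb (a b c d : EuclideanSpace ℝ (Fin 2)) (hab : dist a b = 1) (hbc : dist b c = 1)
    (hcd : dist c d = 1) (hda : dist d a = 1) (hac : a ≠ c) (hbd : b ≠ d) :
    a 0 + c 0 = b 0 + d 0 ∧ a 1 + c 1 = b 1 + d 1 := by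
  have h1 := dist_one_coord _ _ hab
  have h2 := dist_one_coord _ _ hbc
  have h3 := dist_one_coord _ _ hcd
  have h4 := dist_one_coord _ _ hda
  have key := rhomb_alg (a 0 - c 0) (a 1 - c 1) (a 0 + c 0 - b 0 - d 0) (a 1 + c 1 - b 1 - d 1)
    (b 0 - d 0) (b 1 - d 1)
    (by linear_combination (-1/2) * h1 + (1/2) * h2 - (1/2) * h3 + (1/2) * h4)
    (by linear_combination (1/2) * h1 - (1/2) * h2 - (1/2) * h3 + (1/2) * h4)
    (by linear_combination (-1/2) * h1 - (1/2) * h2 + (1/2) * h3 + (1/2) * h4)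
    (by
      rintro ⟨h, h'⟩
      apply hac
      ext i
      fin_cases i
      · exact sub_eq_zero.1 h
      · exact sub_eq_zero.1 h')
    (by
      rintro ⟨h, h'⟩
      apply hbd
      ext i
      fin_cases i
      · exact sub_eq_zero.1 h
      · exact sub_eq_zero.1 h')
  constructor <;> linarith [key.1, key.2]

theorem F_8_12_3_forbidden :
    ¬ ∃ φ : ℕ → EuclideanSpace ℝ (Fin 2),
      Set.InjOn φ (Set.Icc 1 8) ∧
      dist (φ 1) (φ 2) = 1 ∧
      dist (φ 2) (φ 4) = 1 ∧
      dist (φ 3) (φ 4) = 1 ∧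
      dist (φ 1) (φ 3) = 1 ∧
      dist (φ 3) (φ 5) = 1 ∧
      dist (φ 5) (φ 7) = 1 ∧
      dist (φ 7) (φ 8) = 1 ∧
      dist (φ 6) (φ 8) = 1 ∧
      dist (φ 4) (φ 6) = 1 ∧
      dist (φ 5) (φ 6) = 1 ∧
      dist (φ 1) (φ 8) = 1 ∧
      dist (φ 2) (φ 7) = 1 := by
  rintro ⟨φ, hi, h12, h24, h34, h13, h35, h57, h78, h68, h46, h56, h18, h27⟩
  have ne : ∀ i j : ℕ, 1 ≤ i → i ≤ 8 → 1 ≤ j → j ≤ 8 → i ≠ j → φ i ≠ φ j :=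
    fun i j a b c d hij h => hij (hi ⟨a, b⟩ ⟨c, d⟩ h)
  have r1 := rhomb (φ 1) (φ 2) (φ 4) (φ 3) h12 h24 (dist_comm (φ 3) _ ▸ h34)
    (dist_comm (φ 1) _ ▸ h13) (ne _ _ (by norm_num) (by norm_num) (by norm_num) (by norm_num)
    (by norm_num)) (ne _ _ (by norm_num) (by norm_num) (by norm_num) (by norm_num) (by norm_num))
  have r2 := rhomb (φ 1) (φ 2) (φ 7) (φ 8) h12 h27 h78
    (dist_comm (φ 1) _ ▸ h18) (ne _ _ (by norm_num) (by norm_num) (by norm_num) (by norm_num)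
    (by norm_num)) (ne _ _ (by norm_num) (by norm_num) (by norm_num) (by norm_num) (by norm_num))
  have r3 := rhomb (φ 5) (φ 7) (φ 8) (φ 6) h57 h78 (dist_comm (φ 6) _ ▸ h68)
    (dist_comm (φ 5) _ ▸ h56) (ne _ _ (by norm_num) (by norm_num) (by norm_num) (by norm_num)
    (by norm_num)) (ne _ _ (by norm_num) (by norm_num) (by norm_num) (by norm_num) (by norm_num))
  have r4 := rhomb (φ 3) (φ 4) (φ 6) (φ 5) h34 h46 (dist_comm (φ 5) _ ▸ h56)
    (dist_comm (φ 3) _ ▸ h35) (ne _ _ (by norm_num) (by norm_num) (by norm_num) (by norm_num)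
    (by norm_num)) (ne _ _ (by norm_num) (by norm_num) (by norm_num) (by norm_num) (by norm_num))
  apply ne 1 2 (by norm_num) (by norm_num) (by norm_num) (by norm_num) (by norm_num)
  ext i
  fin_cases i
  · show φ 1 0 = φ 2 0
    linarith [r1.1, r2.1, r3.1, r4.1]
  · show φ 1 1 = φ 2 1
    linarith [r1.2, r2.2, r3.2, r4.2]
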